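/- There exists a constant C > 0 such that for every integer n ≥ 2 there exists a deterministic online sorting strategy s for array size n with Pr_x[cost(s,x) ≤ (log n)^C] ≥ 1 − C/n^{10}, where the probability is over an input x of n i.i.d. uniform samples from [0,1]. In other words, there is a deterministic algorithm for stochastic online sorting that achieves polylogarithmic cost with probability 1 − O(1/n^{10}). -/

import Mathlib

open MeasureTheory

/-- The distribution of `n` i.i.d. uniform samples from `[0,1]`. -/
noncomputable def uniformCube (n : ℕ) : Measure (Fin n → ℝ) :=
  Measure.pi fun _ => (volume : Measure ℝ).restrict (Set.Icc 0 1)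

/-- A deterministic online sorting strategy for array size `n`: upon arrival of the
`(k+1)`-st item, it is placed into cell `place x k`, which depends only on the first
`k+1` items and is distinct from all previously used cells. -/
structure OnlineStrategy (n : ℕ) where
  place : (Fin n → ℝ) → Fin n → Fin n
  online : ∀ x y : Fin n → ℝ, ∀ k : Fin n,
    (∀ i : Fin n, i ≤ k → x i = y i) → place x k = place y k
  inj : ∀ x : Fin n → ℝ, Function.Injective (place x)
  meas : ∀ k : Fin n, Measurable fun x => place x k

/-- The final array produced by the strategy (cells indexed `0,…,n-1`):
cell `j` holds the item inserted at the unique time `k` with `place x k = j`. -/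
noncomputable def strategyArr {n : ℕ} (S : OnlineStrategy n) (x : Fin n → ℝ) (j : ℕ) : ℝ :=
  if h : j < n then
    haveI : Nonempty (Fin n) := ⟨⟨j, h⟩⟩
    x (Function.invFun (S.place x) ⟨j, h⟩)
  else 0

/-- The cost: the sum of absolute differences between adjacent cells. -/
noncomputable def strategyCost {n : ℕ} (S : OnlineStrategy n) (x : Fin n → ℝ) : ℝ :=
  ∑ j ∈ Finset.range (n - 1), |strategyArr S x (j + 1) - strategyArr S x j|

/-- A partially filled array: the occupied cells, and the target labels of the initial segment of
cells that has been committed so far. -/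
structure FillState where
  occ : Finset ℕ
  tgt : List ℕ

namespace FillState

/-- The empty committed cells whose target has label `i` at level `j`. -/
def holes (S : FillState) (j i : ℕ) : Finset ℕ :=
  (Finset.range S.tgt.length).filter fun c => c ∉ S.occ ∧ S.tgt.getD c 0 / 2 ^ j = i

/-- Increasing targets that raise the number of holes of every level-`j` label to `h`. -/
def refill (h j : ℕ) (S : FillState) (m : ℕ) : List ℕ :=
  (List.range m).flatMap fun i => List.replicate (h - (S.holes j i).card) (i * 2 ^ j)

/-- Commit further cells so that every level-`j` label has at least `h` holes. -/
def commit (a h j : ℕ) (S : FillState) : FillState :=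
  ⟨S.occ, S.tgt ++ S.refill h j (2 ^ (a - j))⟩

open Classical in
/-- The cell for an item of label `y` at level `j`: a hole of that label if there is one, and any
empty cell otherwise. -/
noncomputable def pick (n : ℕ) (S : FillState) (j y : ℕ) : ℕ :=
  if H : ∃ c ∈ S.holes j (y / 2 ^ j), c < n then H.choose
  else if H : ∃ c, c < n ∧ c ∉ S.occ then H.choose else 0

theorem mem_holes {S : FillState} {j i c : ℕ} :
    c ∈ S.holes j i ↔ c < S.tgt.length ∧ c ∉ S.occ ∧ S.tgt.getD c 0 / 2 ^ j = i := by
  simp [holes]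

theorem pick_lt {n : ℕ} (hn : 0 < n) (S : FillState) (j y : ℕ) : S.pick n j y < n := by
  unfold pick
  split_ifs with H H'
  · exact H.choose_spec.2
  · exact H'.choose_spec.1
  · exact hn

theorem pick_notMem {n : ℕ} (S : FillState) (j y : ℕ) (hc : S.occ.card < n) :
    S.pick n j y ∉ S.occ := by
  unfold pick
  have : ∃ c, c < n ∧ c ∉ S.occ := by
    by_contra! H
    have : Finset.range n ⊆ S.occ := fun c hc => H c (Finset.mem_range.1 hc)
    have := Finset.card_le_card this
    simp at this
    omega
  split_ifs with H
  · exact (mem_holes.1 H.choose_spec.1).2.1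
  · exact this.choose_spec.2

theorem pick_mem_holes {n : ℕ} (S : FillState) (j y : ℕ) (hl : S.tgt.length ≤ n)
    (H : (S.holes j (y / 2 ^ j)).Nonempty) : S.pick n j y ∈ S.holes j (y / 2 ^ j) := by
  have H' : ∃ c ∈ S.holes j (y / 2 ^ j), c < n := by
    obtain ⟨c, hc⟩ := H
    exact ⟨c, hc, (mem_holes.1 hc).1.trans_le hl⟩
  unfold pick
  rw [dif_pos H']
  exact H'.choose_spec.1

theorem countP_refill (h j : ℕ) (S : FillState) (m i : ℕ) :
    (S.refill h j m).countP (fun t => t / 2 ^ j = i) =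
      if i < m then h - (S.holes j i).card else 0 := by
  induction m with
  | zero => simp [refill]
  | succ m ih =>
    have : S.refill h j (m + 1) =
        S.refill h j m ++ List.replicate (h - (S.holes j m).card) (m * 2 ^ j) := by
      simp [refill, List.range_succ]
    rw [this, List.countP_append, ih, List.countP_replicate]
    simp only [Nat.mul_div_cancel _ (Nat.two_pow_pos j), decide_eq_true_eq]
    rcases lt_trichotomy i m with H | H | H
    · rw [if_pos H, if_neg (by omega), if_pos (by omega)]; simp
    · subst H; simp
    · rw [if_neg (by omega), if_neg (by omega), if_neg (by omega)]

theorem refill_pairwise (h j : ℕ) (S : FillState) (m : ℕ) :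
    (S.refill h j m).Pairwise (· ≤ ·) := by
  rw [refill, List.pairwise_flatMap]
  refine ⟨fun i _ => List.pairwise_replicate.2 (Or.inr le_rfl), ?_⟩
  refine List.Pairwise.imp ?_ List.pairwise_lt_range
  intro p q hpq x hx y hy
  rw [List.eq_of_mem_replicate hx, List.eq_of_mem_replicate hy]
  exact Nat.mul_le_mul_right _ hpq.le

theorem lt_of_mem_refill {a h j : ℕ} {S : FillState} (hj : j ≤ a) {t : ℕ}
    (ht : t ∈ S.refill h j (2 ^ (a - j))) : t < 2 ^ a := by
  rw [refill, List.mem_flatMap] at ht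
  obtain ⟨i, hi, ht⟩ := ht
  rw [List.eq_of_mem_replicate ht]
  calc i * 2 ^ j < 2 ^ (a - j) * 2 ^ j :=
        Nat.mul_lt_mul_of_pos_right (List.mem_range.1 hi) (Nat.two_pow_pos j)
    _ = 2 ^ a := by rw [← pow_add]; congr 1; omega

end FillState

theorem card_filter_getD (l : List ℕ) (p : ℕ → Prop) [DecidablePred p] :
    ((Finset.range l.length).filter fun c => p (l.getD c 0)).card = l.countP (fun t => p t) := by
  induction l using List.reverseRecOn with
  | nil => simp
  | append_singleton l t ih =>
    rw [List.length_append, List.length_singleton, Finset.range_add_one, Finset.filter_insert,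
      List.countP_append, ← ih]
    have h1 : (Finset.range l.length).filter (fun c => p ((l ++ [t]).getD c 0)) =
        (Finset.range l.length).filter (fun c => p (l.getD c 0)) := by
      refine Finset.filter_congr fun c hc => ?_
      rw [List.getD_append _ _ _ _ (Finset.mem_range.1 hc)]
    have h2 : (l ++ [t]).getD l.length 0 = t := by simp
    rw [h1, h2]
    by_cases ht : p t
    · rw [if_pos ht, Finset.card_insert_of_notMem (by simp)]
      simp [ht]
    · rw [if_neg ht]
      simp [ht]

namespace FillState

/-- The properties of the state that persist as long as every item finds a matching hole. -/
structure Tame (a : ℕ) (S : FillState) : Prop where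
  occ_lt : ∀ c ∈ S.occ, c < S.tgt.length
  tgt_lt : ∀ t ∈ S.tgt, t < 2 ^ a

theorem Tame.getD_lt {a : ℕ} {S : FillState} (hS : S.Tame a) (c : ℕ) :
    S.tgt.getD c 0 < 2 ^ a := by
  rcases lt_or_ge c S.tgt.length with h | h
  · rw [List.getD_eq_getElem _ _ h]
    exact hS.tgt_lt _ (List.getElem_mem h)
  · rw [List.getD_eq_default _ _ h]
    positivity

theorem Tame.commit {a : ℕ} {S : FillState} (hS : S.Tame a) {j : ℕ} (hj : j ≤ a) (h : ℕ) :
    (S.commit a h j).Tame a where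
  occ_lt c hc := by
    have := hS.occ_lt c hc
    simp only [FillState.commit, List.length_append]
    omega
  tgt_lt t ht := by
    simp only [FillState.commit, List.mem_append] at ht
    exact ht.elim (hS.tgt_lt t) (lt_of_mem_refill hj)

theorem card_holes_commit {a : ℕ} {S : FillState} (hS : S.Tame a) (h j i : ℕ)
    (hi : i < 2 ^ (a - j)) (hh : (S.holes j i).card ≤ h) :
    ((S.commit a h j).holes j i).card = h := by
  set R := S.refill h j (2 ^ (a - j)) with hR
  have key : (S.commit a h j).holes j i = S.holes j i ∪
      ((Finset.range R.length).filter fun c => R.getD c 0 / 2 ^ j = i).map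
        (addLeftEmbedding S.tgt.length) := by
    ext c
    simp only [mem_holes, Finset.mem_union, Finset.mem_map, Finset.mem_filter, Finset.mem_range,
      addLeftEmbedding_apply, FillState.commit, List.length_append, ← hR]
    constructor
    · rintro ⟨h1, h2, h3⟩
      rcases lt_or_ge c S.tgt.length with hc | hc
      · rw [List.getD_append _ _ _ _ hc] at h3
        exact Or.inl ⟨hc, h2, h3⟩
      · rw [List.getD_append_right _ _ _ _ hc] at h3
        exact Or.inr ⟨c - S.tgt.length, ⟨by omega, h3⟩, by omega⟩
    · rintro (⟨h1, h2, h3⟩ | ⟨d, ⟨h1, h2⟩, rfl⟩)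
      · rw [List.getD_append _ _ _ _ h1]
        exact ⟨by omega, h2, h3⟩
      · rw [List.getD_append_right _ _ _ _ (by omega)]
        refine ⟨by omega, fun hd => ?_, by simpa using h2⟩
        have := hS.occ_lt _ hd
        omega
  rw [key, Finset.card_union_of_disjoint, Finset.card_map,
    card_filter_getD R (fun t => t / 2 ^ j = i), hR, countP_refill, if_pos hi]
  · omega
  · rw [Finset.disjoint_left]
    intro c hc hc'
    simp only [Finset.mem_map, Finset.mem_filter, addLeftEmbedding_apply] at hc'
    obtain ⟨d, -, rfl⟩ := hc'
    have := (mem_holes.1 hc).1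
    omega

theorem Tame.length_eq {a : ℕ} {S : FillState} (hS : S.Tame a) {j : ℕ} (hj : j ≤ a) :
    S.tgt.length = S.occ.card + ∑ i ∈ Finset.range (2 ^ (a - j)), (S.holes j i).card := by
  have h1 : (Finset.range S.tgt.length \ S.occ).card =
      ∑ i ∈ Finset.range (2 ^ (a - j)), (S.holes j i).card := by
    rw [Finset.card_eq_sum_card_fiberwise (f := fun c => S.tgt.getD c 0 / 2 ^ j)
      (t := Finset.range (2 ^ (a - j)))]
    · refine Finset.sum_congr rfl fun i _ => congrArg _ ?_
      ext c
      simp [mem_holes, and_assoc]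
    · intro c _
      simp only [Finset.coe_range, Set.mem_Iio]
      rw [Nat.div_lt_iff_lt_mul (Nat.two_pow_pos j), ← pow_add, Nat.sub_add_cancel hj]
      exact hS.getD_lt c
  have h2 : S.occ ⊆ Finset.range S.tgt.length := fun c hc => Finset.mem_range.2 (hS.occ_lt c hc)
  have h3 := Finset.card_sdiff_add_card_eq_card h2
  rw [Finset.card_range] at h3
  omega

theorem Tame.insert {a : ℕ} {S : FillState} (hS : S.Tame a) {c : ℕ} (hc : c < S.tgt.length) :
    (⟨insert c S.occ, S.tgt⟩ : FillState).Tame a where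
  occ_lt d hd := by
    rcases Finset.mem_insert.1 hd with rfl | hd
    · exact hc
    · exact hS.occ_lt d hd
  tgt_lt := hS.tgt_lt

theorem card_holes_insert (S : FillState) {j i₀ c : ℕ} (hc : c ∈ S.holes j i₀) (i : ℕ) :
    ((⟨insert c S.occ, S.tgt⟩ : FillState).holes j i).card + (if i₀ = i then 1 else 0) =
      (S.holes j i).card := by
  have key : (⟨insert c S.occ, S.tgt⟩ : FillState).holes j i = (S.holes j i).erase c := by
    ext d
    simp only [mem_holes, Finset.mem_erase, Finset.mem_insert, not_or]
    tauto
  rw [key]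
  split_ifs with h
  · subst h
    exact Finset.card_erase_add_one hc
  · rw [Finset.erase_eq_of_notMem, add_zero]
    intro hc'
    exact h ((mem_holes.1 hc).2.2.symm.trans (mem_holes.1 hc').2.2)

theorem card_holes_succ (S : FillState) (j i : ℕ) :
    (S.holes (j + 1) i).card = (S.holes j (2 * i)).card + (S.holes j (2 * i + 1)).card := by
  rw [← Finset.card_union_of_disjoint]
  · congr 1
    ext c
    simp only [mem_holes, Finset.mem_union, pow_succ, ← Nat.div_div_eq_div_mul]
    generalize S.tgt.getD c 0 / 2 ^ j = t
    constructor
    · rintro ⟨h1, h2, h3⟩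
      have : t = 2 * i ∨ t = 2 * i + 1 := by omega
      tauto
    · rintro (⟨h1, h2, h3⟩ | ⟨h1, h2, h3⟩) <;> exact ⟨h1, h2, by omega⟩
  · rw [Finset.disjoint_left]
    intro c hc hc'
    have := (mem_holes.1 hc).2.2
    have := (mem_holes.1 hc').2.2
    omega

end FillState

/-- The time at which phase `j` starts. -/
def phaseStart (n j : ℕ) : ℕ := n - n / 2 ^ j

/-- The phase, among `0, …, a`, to which time `k` belongs. -/
def phaseAt (n a k : ℕ) : ℕ := Nat.findGreatest (fun j => phaseStart n j ≤ k) a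

theorem phaseStart_zero (n : ℕ) : phaseStart n 0 = 0 := by simp [phaseStart]

theorem phaseStart_mono (n : ℕ) : Monotone (phaseStart n) := fun i j hij =>
  Nat.sub_le_sub_left (Nat.div_le_div_left (Nat.pow_le_pow_right (by norm_num) hij)
    (Nat.two_pow_pos i)) n

theorem phaseStart_le (n j : ℕ) : phaseStart n j ≤ n := Nat.sub_le _ _

theorem phaseStart_add (n j : ℕ) : phaseStart n j + n / 2 ^ j = n :=
  Nat.sub_add_cancel (Nat.div_le_self _ _)

theorem phaseStart_lt_succ {n a j : ℕ} (hn : 2 ^ a ≤ n) (hj : j < a) :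
    phaseStart n j < phaseStart n (j + 1) := by
  have h1 := phaseStart_add n j
  have h2 := phaseStart_add n (j + 1)
  have h3 : n / 2 ^ (j + 1) = n / 2 ^ j / 2 := by rw [pow_succ, Nat.div_div_eq_div_mul]
  have h4 : 0 < n / 2 ^ j :=
    Nat.div_pos ((Nat.pow_le_pow_right (by norm_num) hj.le).trans hn) (Nat.two_pow_pos j)
  omega

theorem phaseAt_le (n a k : ℕ) : phaseAt n a k ≤ a := Nat.findGreatest_le a

theorem phaseStart_phaseAt_le (n a k : ℕ) : phaseStart n (phaseAt n a k) ≤ k :=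
  Nat.findGreatest_spec (P := fun j => phaseStart n j ≤ k) (Nat.zero_le a)
    (by simp [phaseStart_zero])

theorem phaseAt_eq_of_lt {n a j k : ℕ} (hj : j < a) (h1 : phaseStart n j ≤ k)
    (h2 : k < phaseStart n (j + 1)) : phaseAt n a k = j := by
  rw [phaseAt, Nat.findGreatest_eq_iff]
  refine ⟨hj.le, fun _ => h1, fun i hi _ => ?_⟩
  have := phaseStart_mono n (show j + 1 ≤ i from hi)
  omega

theorem phaseAt_eq_last {n a k : ℕ} (h : phaseStart n a ≤ k) : phaseAt n a k = a :=
  le_antisymm (phaseAt_le n a k) (Nat.le_findGreatest le_rfl h)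

theorem lt_phaseStart_of_phaseAt_lt {n a k : ℕ} (h : phaseAt n a k < a) :
    k < phaseStart n (phaseAt n a k + 1) := by
  by_contra! H
  have : phaseAt n a k + 1 ≤ phaseAt n a k :=
    Nat.le_findGreatest (P := fun j => phaseStart n j ≤ k) h H
  omega

namespace FillState

/-- Commit further cells if time `k` starts one of the phases `0, …, a - 1`. -/
def prep (n a h k : ℕ) (S : FillState) : FillState :=
  if phaseAt n a k < a ∧ k = phaseStart n (phaseAt n a k) then S.commit a h (phaseAt n a k) else S

/-- The state after the first `k` items with labels `y 0, y 1, …` have been placed. -/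
noncomputable def fill (n a h : ℕ) (y : ℕ → ℕ) : ℕ → FillState
  | 0 => ⟨∅, []⟩
  | k + 1 => ⟨insert (((fill n a h y k).prep n a h k).pick n (phaseAt n a k) (y k))
      (fill n a h y k).occ, ((fill n a h y k).prep n a h k).tgt⟩

/-- The cell in which item `k` is placed. -/
noncomputable def cell (n a h : ℕ) (y : ℕ → ℕ) (k : ℕ) : ℕ :=
  ((fill n a h y k).prep n a h k).pick n (phaseAt n a k) (y k)

@[simp] theorem prep_occ (n a h k : ℕ) (S : FillState) : (S.prep n a h k).occ = S.occ := by
  unfold prep; split_ifs <;> rfl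

theorem prep_eq_self {n a h k : ℕ} {S : FillState}
    (hk : ¬ (phaseAt n a k < a ∧ k = phaseStart n (phaseAt n a k))) : S.prep n a h k = S :=
  if_neg hk

section

variable {n a h : ℕ} {y : ℕ → ℕ}

theorem cell_lt (hn : 0 < n) (k : ℕ) : cell n a h y k < n := pick_lt hn _ _ _

theorem fill_succ (k : ℕ) : fill n a h y (k + 1) =
    ⟨insert (cell n a h y k) ((fill n a h y k).prep n a h k).occ,
      ((fill n a h y k).prep n a h k).tgt⟩ := by
  simp [fill, cell]

theorem fill_congr {y z : ℕ → ℕ} (k : ℕ) (hyz : ∀ i < k, y i = z i) :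
    fill n a h y k = fill n a h z k := by
  induction k with
  | zero => rfl
  | succ k ih =>
    have := ih fun i hi => hyz i (hi.trans k.lt_succ_self)
    simp only [fill, this, hyz k k.lt_succ_self]

theorem cell_congr {y z : ℕ → ℕ} (k : ℕ) (hyz : ∀ i ≤ k, y i = z i) :
    cell n a h y k = cell n a h z k := by
  rw [cell, cell, fill_congr k fun i hi => hyz i hi.le, hyz k le_rfl]

theorem card_occ_le (k : ℕ) : (fill n a h y k).occ.card ≤ k := by
  induction k with
  | zero => simp [fill]
  | succ k ih =>
    rw [fill]
    exact (Finset.card_insert_le _ _).trans (Nat.succ_le_succ ih)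

theorem cell_notMem {k : ℕ} (hk : k < n) : cell n a h y k ∉ (fill n a h y k).occ := by
  have := pick_notMem (n := n) ((fill n a h y k).prep n a h k) (phaseAt n a k) (y k)
    (by simpa using (card_occ_le k).trans_lt hk)
  rwa [prep_occ] at this

theorem card_occ {k : ℕ} (hk : k ≤ n) : (fill n a h y k).occ.card = k := by
  induction k with
  | zero => simp [fill]
  | succ k ih =>
    rw [fill_succ, prep_occ, Finset.card_insert_of_notMem (cell_notMem hk), ih (by omega)]

theorem occ_mono : Monotone fun k => (fill n a h y k).occ :=
  monotone_nat_of_le_succ fun k => by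
    simp only [fill_succ, prep_occ]
    exact Finset.subset_insert _ _

theorem cell_ne {k l : ℕ} (hkl : k < l) (hl : l < n) : cell n a h y k ≠ cell n a h y l := by
  intro H
  apply cell_notMem (a := a) (h := h) (y := y) hl
  rw [← H]
  refine occ_mono (show k + 1 ≤ l from hkl) ?_
  simp [fill_succ]

theorem tgt_prefix_prep (k : ℕ) :
    (fill n a h y k).tgt <+: ((fill n a h y k).prep n a h k).tgt := by
  unfold prep
  split_ifs
  · exact List.prefix_append _ _
  · exact List.prefix_rfl

theorem tgt_prefix_of_le {k l : ℕ} (hkl : k ≤ l) :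
    (fill n a h y k).tgt <+: (fill n a h y l).tgt := by
  induction l, hkl using Nat.le_induction with
  | base => exact List.prefix_rfl
  | succ l _ ih =>
    rw [fill_succ]
    exact ih.trans (tgt_prefix_prep l)

/-- The number of items of level-`j` label `i` that arrive during phase `j` before time `k`. -/
def phaseCount (n : ℕ) (y : ℕ → ℕ) (j i k : ℕ) : ℕ :=
  ((Finset.Ico (phaseStart n j) k).filter fun l => y l / 2 ^ j = i).card

theorem phaseCount_succ {j i k : ℕ} (hk : phaseStart n j ≤ k) :
    phaseCount n y j i (k + 1) = phaseCount n y j i k + if y k / 2 ^ j = i then 1 else 0 := by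
  rw [phaseCount, ← Finset.insert_Ico_right_eq_Ico_add_one hk, Finset.filter_insert]
  split_ifs
  · rw [Finset.card_insert_of_notMem (by simp), phaseCount]
  · rw [phaseCount, add_zero]

theorem phaseCount_mono {j i k l : ℕ} (hkl : k ≤ l) :
    phaseCount n y j i k ≤ phaseCount n y j i l :=
  Finset.card_le_card (Finset.filter_subset_filter _ (Finset.Ico_subset_Ico_right hkl))

/-- Labels that are evenly spread over all phases. -/
structure Balanced (n a h : ℕ) (y : ℕ → ℕ) : Prop where
  lt : ∀ k < n, y k < 2 ^ a
  count_le : ∀ j < a, ∀ i < 2 ^ (a - j), phaseCount n y j i (phaseStart n (j + 1)) ≤ h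
  le_count : ∀ j < a, ∀ i < 2 ^ (a - j), h ≤ 2 * phaseCount n y j i (phaseStart n (j + 1))

/-- The invariant inside phase `j` just before time `k`. -/
structure InPhase (n a h : ℕ) (y : ℕ → ℕ) (j k : ℕ) (S : FillState) : Prop where
  tame : S.Tame a
  length_le : S.tgt.length ≤ n
  card_add : ∀ i < 2 ^ (a - j), (S.holes j i).card + phaseCount n y j i k = h

/-- The invariant at the beginning of phase `j`. -/
structure AtStart (a h j : ℕ) (S : FillState) : Prop where
  tame : S.Tame a
  card_le : j < a → ∀ i < 2 ^ (a - j), (S.holes j i).card ≤ h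

theorem AtStart.inPhase (hh : h ≤ n / 2 ^ a) {j : ℕ} (hj : j < a)
    (H : (fill n a h y (phaseStart n j)).AtStart a h j) (hn : 2 ^ a ≤ n) :
    ((fill n a h y (phaseStart n j)).prep n a h (phaseStart n j)).InPhase n a h y j
      (phaseStart n j) := by
  have hp : phaseAt n a (phaseStart n j) = j :=
    phaseAt_eq_of_lt hj le_rfl (phaseStart_lt_succ hn hj)
  have hprep : (fill n a h y (phaseStart n j)).prep n a h (phaseStart n j) =
      (fill n a h y (phaseStart n j)).commit a h j := by
    rw [prep, hp, if_pos ⟨hj, rfl⟩]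
  rw [hprep]
  have hT := H.tame.commit hj.le h
  have hc : ∀ i < 2 ^ (a - j),
      (((fill n a h y (phaseStart n j)).commit a h j).holes j i).card = h := fun i hi =>
    card_holes_commit H.tame h j i hi (H.card_le hj i hi)
  refine ⟨hT, ?_, fun i hi => ?_⟩
  · rw [hT.length_eq hj.le, Finset.sum_congr rfl fun i hi => hc i (Finset.mem_range.1 hi)]
    simp only [FillState.commit, Finset.sum_const, Finset.card_range, smul_eq_mul]
    rw [card_occ (phaseStart_le n j)]
    have h1 := phaseStart_add n j
    have h2 : 2 ^ (a - j) * (n / 2 ^ a) ≤ n / 2 ^ j := by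
      have : n / 2 ^ a = n / 2 ^ j / 2 ^ (a - j) := by
        rw [Nat.div_div_eq_div_mul, ← pow_add]; congr 2; omega
      rw [this]
      exact Nat.mul_div_le _ _
    have h3 : 2 ^ (a - j) * h ≤ 2 ^ (a - j) * (n / 2 ^ a) := Nat.mul_le_mul_left _ hh
    omega
  · rw [hc i hi]
    simp [phaseCount]

theorem label_lt {j : ℕ} (hj : j ≤ a) {t : ℕ} (ht : t < 2 ^ a) : t / 2 ^ j < 2 ^ (a - j) := by
  rwa [Nat.div_lt_iff_lt_mul (Nat.two_pow_pos j), ← pow_add, Nat.sub_add_cancel hj]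

theorem InPhase.cell_mem (hy : Balanced n a h y) {j k : ℕ} (hj : j < a)
    (hjk : phaseStart n j ≤ k) (hk : k < phaseStart n (j + 1))
    (H : ((fill n a h y k).prep n a h k).InPhase n a h y j k) :
    cell n a h y k ∈ ((fill n a h y k).prep n a h k).holes j (y k / 2 ^ j) := by
  have hp : phaseAt n a k = j := phaseAt_eq_of_lt hj hjk hk
  rw [cell, hp]
  refine pick_mem_holes _ _ _ H.length_le ?_
  have hi := label_lt hj.le (hy.lt k (hk.trans_le (phaseStart_le _ _)))
  have h1 := H.card_add _ hi
  have h2 := phaseCount_succ (n := n) (y := y) (i := y k / 2 ^ j) hjk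
  have h3 := phaseCount_mono (n := n) (y := y) (j := j) (i := y k / 2 ^ j) (Nat.succ_le_of_lt hk)
  have h4 := hy.count_le j hj _ hi
  rw [if_pos rfl] at h2
  rw [← Finset.card_pos]
  simp only [Nat.succ_eq_add_one] at h3
  omega

theorem InPhase.fill_succ (hy : Balanced n a h y) {j k : ℕ} (hj : j < a)
    (hjk : phaseStart n j ≤ k) (hk : k < phaseStart n (j + 1))
    (H : ((fill n a h y k).prep n a h k).InPhase n a h y j k) :
    (fill n a h y (k + 1)).InPhase n a h y j (k + 1) := by
  have hc := H.cell_mem hy hj hjk hk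
  rw [FillState.fill_succ]
  refine ⟨H.tame.insert (mem_holes.1 hc).1, H.length_le, fun i hi => ?_⟩
  have h1 := H.card_add i hi
  have h2 := card_holes_insert _ hc i
  rw [phaseCount_succ hjk]
  omega

theorem InPhase.of_le (hy : Balanced n a h y) {j : ℕ} (hj : j < a)
    (H : ((fill n a h y (phaseStart n j)).prep n a h (phaseStart n j)).InPhase n a h y j
      (phaseStart n j)) {k : ℕ} (hjk : phaseStart n j ≤ k) (hk : k < phaseStart n (j + 1)) :
    ((fill n a h y k).prep n a h k).InPhase n a h y j k := by
  induction k, hjk using Nat.le_induction with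
  | base => exact H
  | succ k hjk ih =>
    rw [prep_eq_self]
    · exact (ih (by omega)).fill_succ hy hj hjk (by omega)
    · rw [phaseAt_eq_of_lt hj (by omega) hk]
      omega

theorem InPhase.atStart (hy : Balanced n a h y) {j : ℕ} (hj : j < a) {S : FillState}
    (H : S.InPhase n a h y j (phaseStart n (j + 1))) : S.AtStart a h (j + 1) := by
  refine ⟨H.tame, fun hj' i hi => ?_⟩
  have h2 : 2 ^ (a - j) = 2 * 2 ^ (a - (j + 1)) := by
    rw [← pow_succ']; congr 1; omega
  have e1 := H.card_add (2 * i) (by omega)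
  have e2 := H.card_add (2 * i + 1) (by omega)
  have f1 := hy.le_count j hj (2 * i) (by omega)
  have f2 := hy.le_count j hj (2 * i + 1) (by omega)
  rw [card_holes_succ]
  omega

theorem atStart (hy : Balanced n a h y) (hn : 2 ^ a ≤ n) (hh : h ≤ n / 2 ^ a) {j : ℕ}
    (hj : j ≤ a) : (fill n a h y (phaseStart n j)).AtStart a h j := by
  induction j with
  | zero =>
    rw [phaseStart_zero]
    refine ⟨⟨?_, ?_⟩, ?_⟩ <;> simp [fill, holes]
  | succ j ih =>
    have hlt := phaseStart_lt_succ hn hj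
    have H := (ih (by omega)).inPhase hh hj hn
    have H' := (H.of_le hy hj (k := phaseStart n (j + 1) - 1) (by omega) (by omega)).fill_succ hy hj
      (by omega) (by omega)
    rw [Nat.sub_add_cancel (by omega)] at H'
    exact H'.atStart hy hj

theorem tgt_eq_of_le {k : ℕ} (hk : phaseStart n a ≤ k) :
    (fill n a h y k).tgt = (fill n a h y (phaseStart n a)).tgt := by
  induction k, hk using Nat.le_induction with
  | base => rfl
  | succ k hk ih =>
    rw [fill_succ, prep_eq_self, ih]
    rw [phaseAt_eq_last hk]
    omega

/-- On balanced labels every item has, at the level of its phase, the label of the target of its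
cell. -/
theorem tgt_cell (hy : Balanced n a h y) (hn : 2 ^ a ≤ n) (hh : h ≤ n / 2 ^ a) {k : ℕ}
    (hk : k < n) : (fill n a h y n).tgt.getD (cell n a h y k) 0 / 2 ^ phaseAt n a k =
      y k / 2 ^ phaseAt n a k := by
  rcases (phaseAt_le n a k).lt_or_eq with hj | hj
  · set j := phaseAt n a k with hjdef
    have h1 : phaseStart n j ≤ k := phaseStart_phaseAt_le n a k
    have h2 : k < phaseStart n (j + 1) := lt_phaseStart_of_phaseAt_lt hj
    have H := ((atStart hy hn hh hj.le).inPhase hh hj hn).of_le hy hj h1 h2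
    have hc := mem_holes.1 (H.cell_mem hy hj h1 h2)
    rw [← hc.2.2]
    have hp : ((fill n a h y k).prep n a h k).tgt <+: (fill n a h y n).tgt := by
      have := tgt_prefix_of_le (n := n) (a := a) (h := h) (y := y) (Nat.succ_le_of_lt hk)
      rwa [Nat.succ_eq_add_one, fill_succ] at this
    obtain ⟨l, hl⟩ := hp
    rw [← hl, List.getD_append _ _ _ _ hc.1]
  · rw [hj, Nat.div_eq_of_lt (hy.lt k hk), Nat.div_eq_of_lt]
    rw [tgt_eq_of_le (phaseStart_le n a)]
    exact (atStart hy hn hh le_rfl).tame.getD_lt _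

end

end FillState

theorem sum_abs_sub_le_of_unimodal {g : ℕ → ℝ} {e : ℕ} {M : ℝ} (hM : ∀ c, g c ≤ M)
    (h0 : ∀ c, 0 ≤ g c) (hmono : ∀ c, c + 1 < e → g c ≤ g (c + 1)) (hz : ∀ c, e ≤ c → g c = 0)
    (N : ℕ) : ∑ c ∈ Finset.range N, |g (c + 1) - g c| ≤ 2 * M := by
  have hM0 : 0 ≤ M := (h0 0).trans (hM 0)
  have key : ∑ c ∈ Finset.range N, |g (c + 1) - g c| ≤ if N < e then g N else 2 * M := by
    induction N with
    | zero =>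
      split_ifs
      · simpa using h0 0
      · simpa using hM0
    | succ N ih =>
      rw [Finset.sum_range_succ]
      rcases lt_trichotomy (N + 1) e with h | h | h
      · rw [if_pos (by omega)] at ih
        rw [if_pos h, abs_of_nonneg (sub_nonneg.2 (hmono N h))]
        linarith
      · rw [if_pos (by omega)] at ih
        rw [if_neg (by omega), hz (N + 1) h.ge, zero_sub, abs_neg, abs_of_nonneg (h0 N)]
        linarith [hM N]
      · rw [if_neg (by omega)] at ih
        rw [if_neg (by omega), hz (N + 1) (by omega), hz N (by omega)]
        simpa using ih
  refine key.trans ?_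
  split_ifs
  · linarith [hM N]
  · exact le_rfl

theorem sum_abs_sub_getD_append_le (A B : List ℕ) {M : ℕ} (hB : B.Pairwise (· ≤ ·))
    (hM : ∀ t ∈ B, t ≤ M) (N : ℕ) :
    ∑ c ∈ Finset.range N, |((A ++ B).getD (c + 1) 0 : ℝ) - ((A ++ B).getD c 0 : ℝ)| ≤
      ∑ c ∈ Finset.range N, |(A.getD (c + 1) 0 : ℝ) - (A.getD c 0 : ℝ)| + 2 * M := by
  set g : ℕ → ℝ := fun c => if c < A.length then 0 else (B.getD (c - A.length) 0 : ℝ) with hg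
  have hadd : ∀ c, ((A ++ B).getD c 0 : ℝ) = (A.getD c 0 : ℝ) + g c := by
    intro c
    simp only [hg]
    split_ifs with hc
    · rw [List.getD_append _ _ _ _ hc, add_zero]
    · rw [List.getD_append_right _ _ _ _ (not_lt.1 hc),
        List.getD_eq_default A _ (not_lt.1 hc)]
      simp
  have hgM : ∀ c, B.getD c 0 ≤ M := by
    intro c
    rcases lt_or_ge c B.length with h | h
    · rw [List.getD_eq_getElem _ _ h]
      exact hM _ (List.getElem_mem h)
    · rw [List.getD_eq_default _ _ h]
      exact Nat.zero_le _
  have htv := sum_abs_sub_le_of_unimodal (g := g) (e := A.length + B.length) (M := M)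
    (fun c => by
      simp only [hg]
      split_ifs
      · positivity
      · exact_mod_cast hgM _)
    (fun c => by simp only [hg]; split_ifs <;> positivity)
    (fun c hc => by
      simp only [hg]
      split_ifs
      · exact le_rfl
      · positivity
      · omega
      · rw [Nat.cast_le, List.getD_eq_getElem _ _ (by omega), List.getD_eq_getElem _ _ (by omega)]
        exact List.pairwise_iff_getElem.1 hB _ _ _ _ (by omega))
    (fun c hc => by
      simp only [hg]
      split_ifs
      · rfl
      · rw [List.getD_eq_default _ _ (by omega)]; simp)
    N
  calc _ ≤ ∑ c ∈ Finset.range N, (|(A.getD (c + 1) 0 : ℝ) - (A.getD c 0 : ℝ)| +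
        |g (c + 1) - g c|) := by
        refine Finset.sum_le_sum fun c _ => ?_
        rw [hadd, hadd]
        refine le_trans (le_of_eq ?_) (abs_add_le _ _)
        congr 1
        ring
    _ ≤ _ := by
        rw [Finset.sum_add_distrib]
        linarith

namespace FillState

theorem sum_abs_sub_tgt_le (n a h : ℕ) (y : ℕ → ℕ) (N : ℕ) :
    ∑ c ∈ Finset.range N, |((fill n a h y n).tgt.getD (c + 1) 0 : ℝ) -
      ((fill n a h y n).tgt.getD c 0 : ℝ)| ≤ 2 * 2 ^ a * a := by
  have key : ∀ k, ∑ c ∈ Finset.range N, |((fill n a h y k).tgt.getD (c + 1) 0 : ℝ) -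
      ((fill n a h y k).tgt.getD c 0 : ℝ)| ≤
      2 * 2 ^ a * (((Finset.range a).filter fun j => phaseStart n j < k).card : ℝ) := by
    intro k
    induction k with
    | zero => simp [fill]
    | succ k ih =>
      rw [fill_succ]
      by_cases hk : phaseAt n a k < a ∧ k = phaseStart n (phaseAt n a k)
      · have hcard : ((Finset.range a).filter fun j => phaseStart n j < k).card + 1 ≤
            ((Finset.range a).filter fun j => phaseStart n j < k + 1).card := by
          have hnot : phaseAt n a k ∉ (Finset.range a).filter fun j => phaseStart n j < k := by
            simp only [Finset.mem_filter, not_and]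
            omega
          rw [← Finset.card_insert_of_notMem hnot]
          refine Finset.card_le_card ?_
          intro j hj
          simp only [Finset.mem_insert, Finset.mem_filter, Finset.mem_range] at hj ⊢
          rcases hj with rfl | hj
          · exact ⟨hk.1, by omega⟩
          · exact ⟨hj.1, by omega⟩
        have hcard' : (((Finset.range a).filter fun j => phaseStart n j < k).card : ℝ) + 1 ≤
            (((Finset.range a).filter fun j => phaseStart n j < k + 1).card : ℝ) := by
          exact_mod_cast hcard
        rw [prep, if_pos hk]
        have := sum_abs_sub_getD_append_le (fill n a h y k).tgt
          ((fill n a h y k).refill h (phaseAt n a k) (2 ^ (a - phaseAt n a k))) (M := 2 ^ a)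
          (refill_pairwise _ _ _ _) (fun t ht => (lt_of_mem_refill hk.1.le ht).le) N
        refine this.trans ?_
        push_cast
        have h2 : (0 : ℝ) < 2 ^ a := by positivity
        nlinarith
      · rw [prep_eq_self hk]
        refine ih.trans ?_
        gcongr
        omega
  refine (key n).trans ?_
  gcongr
  exact (Finset.card_filter_le _ _).trans (by simp)

end FillState

theorem sum_two_pow_phaseAt_le (n a : ℕ) :
    ∑ k ∈ Finset.range n, (2 : ℝ) ^ phaseAt n a k ≤ (a + 1) * n := by
  have hmaps : ∀ k ∈ Finset.range n, phaseAt n a k ∈ Finset.range (a + 1) := fun k _ =>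
    Finset.mem_range.2 (Nat.lt_succ_of_le (phaseAt_le n a k))
  rw [← Finset.sum_fiberwise_of_maps_to hmaps]
  have hj : ∀ j ∈ Finset.range (a + 1), ∑ k ∈ Finset.range n with phaseAt n a k = j,
      (2 : ℝ) ^ phaseAt n a k ≤ n := by
    intro j _
    rw [Finset.sum_congr rfl fun k hk => by rw [(Finset.mem_filter.1 hk).2], Finset.sum_const,
      nsmul_eq_mul]
    have hcard : ((Finset.range n).filter fun k => phaseAt n a k = j).card ≤ n / 2 ^ j := by
      have hsub : ((Finset.range n).filter fun k => phaseAt n a k = j) ⊆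
          Finset.Ico (phaseStart n j) n := by
        intro k hk
        simp only [Finset.mem_filter, Finset.mem_range] at hk
        rw [Finset.mem_Ico, ← hk.2]
        exact ⟨phaseStart_phaseAt_le n a k, hk.1⟩
      refine (Finset.card_le_card hsub).trans ?_
      rw [Nat.card_Ico]
      exact (Nat.sub_eq_of_eq_add' (phaseStart_add n j).symm).le
    have : ((Finset.range n).filter fun k => phaseAt n a k = j).card * 2 ^ j ≤ n :=
      (Nat.mul_le_mul_right _ hcard).trans (Nat.div_mul_le_self _ _)
    exact_mod_cast this
  refine (Finset.sum_le_sum hj).trans ?_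
  simp

theorem abs_sub_lt_of_div_eq {p q d : ℕ} (hd : 0 < d) (h : p / d = q / d) :
    |(p : ℝ) - q| ≤ d - 1 := by
  have h1 := Nat.div_add_mod p d
  have h2 := Nat.div_add_mod q d
  have h3 := Nat.mod_lt p hd
  have h4 := Nat.mod_lt q hd
  rw [h] at h1
  have e1 : p + 1 ≤ q + d := by omega
  have e2 : q + 1 ≤ p + d := by omega
  have e1' : (p : ℝ) + 1 ≤ q + d := by exact_mod_cast e1
  have e2' : (q : ℝ) + 1 ≤ p + d := by exact_mod_cast e2
  rw [abs_le]
  constructor <;> linarith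

/-- The extension of a finite sequence by zeros. -/
def extendZero {n : ℕ} (z : Fin n → ℕ) (k : ℕ) : ℕ := if h : k < n then z ⟨k, h⟩ else 0

/-- The labels of the items: the integer parts of their multiples by `2 ^ a`. -/
noncomputable def label (a : ℕ) {n : ℕ} (x : Fin n → ℝ) : ℕ → ℕ :=
  extendZero fun i => ⌊x i * 2 ^ a⌋₊

theorem label_apply (a : ℕ) {n : ℕ} (x : Fin n → ℝ) {k : ℕ} (hk : k < n) :
    label a x k = ⌊x ⟨k, hk⟩ * 2 ^ a⌋₊ := dif_pos hk

/-- The cell of the `k`-th item, as a function of the labels. -/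
noncomputable def fillCell {n : ℕ} (a h : ℕ) (k : Fin n) (z : Fin n → ℕ) : Fin n :=
  ⟨FillState.cell n a h (extendZero z) k, FillState.cell_lt k.pos k⟩

theorem measurable_fillCell {n : ℕ} (a h : ℕ) (k : Fin n) :
    Measurable fun x : Fin n → ℝ => fillCell a h k fun i => ⌊x i * 2 ^ a⌋₊ :=
  (measurable_of_countable (fillCell a h k)).comp <| measurable_pi_lambda _ fun i =>
    Nat.measurable_floor.comp ((measurable_pi_apply i).mul_const _)

/-- The strategy that places items according to their labels. -/
noncomputable def fillStrategy (n a h : ℕ) : OnlineStrategy n where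
  place x k := fillCell a h k fun i => ⌊x i * 2 ^ a⌋₊
  online x y k hxy := by
    refine Fin.ext (FillState.cell_congr _ fun i hi => ?_)
    have hin : i < n := hi.trans_lt k.2
    simp only [extendZero, dif_pos hin, hxy ⟨i, hin⟩ hi]
  inj x k l hkl := by
    have hkl' := Fin.ext_iff.1 hkl
    rcases lt_trichotomy k l with H | H | H
    · exact absurd hkl' (FillState.cell_ne H l.2)
    · exact H
    · exact absurd hkl'.symm (FillState.cell_ne H k.2)
  meas := measurable_fillCell a h

theorem strategyArr_place {n : ℕ} (S : OnlineStrategy n) (x : Fin n → ℝ) (k : Fin n) :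
    strategyArr S x (S.place x k) = x k := by
  have : Nonempty (Fin n) := ⟨k⟩
  rw [strategyArr, dif_pos (S.place x k).2]
  exact congrArg x (Function.leftInverse_invFun (S.inj x) k)

theorem strategyCost_le {n : ℕ} (S : OnlineStrategy n) (x : Fin n → ℝ) (p : ℕ → ℝ) :
    strategyCost S x ≤ 2 * ∑ k : Fin n, |x k - p (S.place x k)| +
      ∑ c ∈ Finset.range n, |p (c + 1) - p c| := by
  have hsum : ∑ k : Fin n, |x k - p (S.place x k)| =
      ∑ c ∈ Finset.range n, |strategyArr S x c - p c| := by
    rw [Finset.sum_range fun c => |strategyArr S x c - p c|]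
    have hb : Function.Bijective (S.place x) := Finite.injective_iff_bijective.1 (S.inj x)
    rw [← hb.sum_comp fun c : Fin n => |strategyArr S x c - p c|]
    exact Finset.sum_congr rfl fun k _ => by rw [strategyArr_place]
  rw [hsum, strategyCost]
  rcases n with _ | m
  · simp
  simp only [Nat.add_sub_cancel]
  have h1 : ∑ c ∈ Finset.range m, |strategyArr S x (c + 1) - p (c + 1)| ≤
      ∑ c ∈ Finset.range (m + 1), |strategyArr S x c - p c| := by
    rw [Finset.sum_range_succ']
    exact le_add_of_nonneg_right (abs_nonneg _)
  have h2 : ∑ c ∈ Finset.range m, |strategyArr S x c - p c| ≤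
      ∑ c ∈ Finset.range (m + 1), |strategyArr S x c - p c| := by
    rw [Finset.sum_range_succ]
    exact le_add_of_nonneg_right (abs_nonneg _)
  have h3 : ∑ c ∈ Finset.range m, |p (c + 1) - p c| ≤
      ∑ c ∈ Finset.range (m + 1), |p (c + 1) - p c| := by
    rw [Finset.sum_range_succ]
    exact le_add_of_nonneg_right (abs_nonneg _)
  have h4 : ∑ c ∈ Finset.range m, |strategyArr S x (c + 1) - strategyArr S x c| ≤
      ∑ c ∈ Finset.range m, (|strategyArr S x (c + 1) - p (c + 1)| + |strategyArr S x c - p c| +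
        |p (c + 1) - p c|) := by
    refine Finset.sum_le_sum fun c _ => ?_
    have := abs_sub_le (strategyArr S x (c + 1)) (p (c + 1)) (strategyArr S x c)
    have := abs_sub_le (p (c + 1)) (p c) (strategyArr S x c)
    rw [abs_sub_comm (p c) (strategyArr S x c)] at this
    linarith
  rw [Finset.sum_add_distrib, Finset.sum_add_distrib] at h4
  linarith

theorem strategyCost_fillStrategy_le {n a h : ℕ} {x : Fin n → ℝ} (hx : ∀ k, 0 ≤ x k)
    (hy : FillState.Balanced n a h (label a x)) (hn : 2 ^ a ≤ n) (hh : h ≤ n / 2 ^ a) :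
    strategyCost (fillStrategy n a h) x ≤ 2 * (a + 1) * n / 2 ^ a + 2 * a := by
  have ha : (0 : ℝ) < 2 ^ a := by positivity
  set T := (FillState.fill n a h (label a x) n).tgt with hT
  refine (strategyCost_le (fillStrategy n a h) x fun c => (T.getD c 0 : ℝ) / 2 ^ a).trans ?_
  have h1 : ∑ k : Fin n, |x k - (T.getD ((fillStrategy n a h).place x k) 0 : ℝ) / 2 ^ a| ≤
      (a + 1) * n / 2 ^ a := by
    calc _ ≤ ∑ k : Fin n, (2 : ℝ) ^ phaseAt n a k / 2 ^ a := by
          refine Finset.sum_le_sum fun k _ => ?_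
          have hc := FillState.tgt_cell hy hn hh k.2
          have hd := abs_sub_lt_of_div_eq (Nat.two_pow_pos (phaseAt n a k)) hc
          rw [← hT] at hd
          have hl : label a x k = ⌊x k * 2 ^ a⌋₊ := label_apply a x k.2
          have hx0 : 0 ≤ x k * 2 ^ a := mul_nonneg (hx k) ha.le
          have hf1 := Nat.floor_le hx0
          have hf2 := (Nat.lt_floor_add_one (x k * 2 ^ a)).le
          rw [← hl] at hf1 hf2
          rw [le_div_iff₀ ha, ← abs_of_pos ha, ← abs_mul, abs_of_pos ha, sub_mul,
            div_mul_cancel₀ _ ha.ne']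
          change |x k * 2 ^ a - (T.getD (FillState.cell n a h (label a x) k) 0 : ℝ)| ≤ _
          push_cast at hd
          rw [abs_le] at hd ⊢
          constructor <;> linarith
      _ = (∑ k ∈ Finset.range n, (2 : ℝ) ^ phaseAt n a k) / 2 ^ a := by
          rw [← Finset.sum_div, Finset.sum_range fun k => (2 : ℝ) ^ phaseAt n a k]
      _ ≤ _ := by
          gcongr
          exact sum_two_pow_phaseAt_le n a
  have h2 : ∑ c ∈ Finset.range n, |(T.getD (c + 1) 0 : ℝ) / 2 ^ a - (T.getD c 0 : ℝ) / 2 ^ a| ≤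
      2 * a := by
    have := FillState.sum_abs_sub_tgt_le n a h (label a x) n
    rw [← hT] at this
    simp_rw [← sub_div, abs_div, abs_of_pos ha]
    rw [← Finset.sum_div, div_le_iff₀ ha]
    linarith
  have h3 : 2 * ((a : ℝ) + 1) * n / 2 ^ a = 2 * ((a + 1) * n / 2 ^ a) := by ring
  rw [h3]
  linarith

theorem integral_exp_ite_mem {Ω : Type*} [MeasurableSpace Ω] (μ : Measure Ω)
    [IsProbabilityMeasure μ] {E : Set Ω} [DecidablePred (· ∈ E)] (hE : MeasurableSet E) (t : ℝ) :
    ∫ u, Real.exp (if u ∈ E then t else 0) ∂μ = 1 + μ.real E * (Real.exp t - 1) := by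
  have : (fun u => Real.exp (if u ∈ E then t else 0)) =
      fun u => 1 + E.indicator (fun _ => Real.exp t - 1) u := by
    funext u
    by_cases hu : u ∈ E <;> simp [hu]
  rw [this, integral_add (integrable_const _) ((integrable_const _).indicator hE),
    integral_indicator_const _ hE]
  simp

theorem measureReal_pi_le_exp {Ω ι : Type*} [MeasurableSpace Ω] [Fintype ι] (μ : Measure Ω)
    [IsProbabilityMeasure μ] {E : Set Ω} [DecidablePred (· ∈ E)] (hE : MeasurableSet E)
    (W : Finset ι) (t c : ℝ) :
    (Measure.pi fun _ : ι => μ).real {x | c ≤ t * ((W.filter fun k => x k ∈ E).card : ℝ)} ≤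
      Real.exp (-c + W.card * μ.real E * (Real.exp t - 1)) := by
  classical
  set f : ι → Ω → ℝ := fun k u => if k ∈ W then Real.exp (if u ∈ E then t else 0) else 1 with hf
  have hfi : ∀ k, Integrable (f k) μ := by
    intro k
    by_cases hk : k ∈ W
    · have : f k = fun u => 1 + E.indicator (fun _ => Real.exp t - 1) u := by
        funext u
        by_cases hu : u ∈ E <;> simp [hf, hk, hu]
      rw [this]
      exact (integrable_const _).add ((integrable_const _).indicator hE)
    · have : f k = fun _ => 1 := by
        funext u
        simp [hf, hk]
      rw [this]
      exact integrable_const _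
  have h_prod_le : ∫ x, ∏ k, f k (x k) ∂(Measure.pi fun _ : ι => μ) ≤
      Real.exp (W.card * μ.real E * (Real.exp t - 1)) := by
    rw [integral_fintype_prod_eq_prod]
    have hk : ∀ k, ∫ u, f k u ∂μ = if k ∈ W then 1 + μ.real E * (Real.exp t - 1) else 1 := by
      intro k
      by_cases hk : k ∈ W
      · simp only [hf, hk, if_true]
        exact integral_exp_ite_mem μ hE t
      · simp [hf, hk]
    simp_rw [hk]
    rw [Finset.prod_ite_mem, Finset.univ_inter, Finset.prod_const, mul_assoc, Real.exp_nat_mul]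
    have h1 : (0 : ℝ) ≤ 1 + μ.real E * (Real.exp t - 1) := by
      rw [← integral_exp_ite_mem μ hE t]
      exact integral_nonneg fun u => (Real.exp_pos _).le
    refine pow_le_pow_left₀ h1 ?_ _
    rw [add_comm]
    exact Real.add_one_le_exp _
  have hprod : ∀ x : ι → Ω, ∏ k, f k (x k) =
      Real.exp (t * ((W.filter fun k => x k ∈ E).card : ℝ)) := by
    intro x
    simp only [hf]
    rw [Finset.prod_ite_mem, Finset.univ_inter, ← Real.exp_sum, ← Finset.sum_filter,
      Finset.sum_const, nsmul_eq_mul, mul_comm]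
  have hmarkov := mul_meas_ge_le_integral_of_nonneg (μ := Measure.pi fun _ : ι => μ)
    (f := fun x => ∏ k, f k (x k)) (Filter.Eventually.of_forall fun x => by
      simp only [hprod]
      exact (Real.exp_pos _).le) (Integrable.fintype_prod hfi) (Real.exp c)
  simp only [hprod, Real.exp_le_exp] at hmarkov h_prod_le
  rw [Real.exp_add, Real.exp_neg, ← div_eq_inv_mul, le_div_iff₀ (Real.exp_pos _), mul_comm]
  exact hmarkov.trans h_prod_le

instance isProbabilityMeasure_restrict_Icc_zero_one :
    IsProbabilityMeasure ((volume : Measure ℝ).restrict (Set.Icc 0 1)) := ⟨by simp⟩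

instance isProbabilityMeasure_uniformCube (n : ℕ) : IsProbabilityMeasure (uniformCube n) :=
  inferInstanceAs (IsProbabilityMeasure (Measure.pi fun _ => _))

theorem measurableSet_floor_div_eq (a j i : ℕ) :
    MeasurableSet {u : ℝ | ⌊u * 2 ^ a⌋₊ / 2 ^ j = i} :=
  (Nat.measurable_floor.comp (measurable_id.mul_const _))
    (.of_discrete : MeasurableSet {m : ℕ | m / 2 ^ j = i})

theorem measureReal_floor_div_eq {a j i : ℕ} (hj : j ≤ a) (hi : i < 2 ^ (a - j)) :
    ((volume : Measure ℝ).restrict (Set.Icc 0 1)).real {u : ℝ | ⌊u * 2 ^ a⌋₊ / 2 ^ j = i} =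
      (2 ^ (a - j))⁻¹ := by
  have hm : (0 : ℝ) < 2 ^ (a - j) := by positivity
  have hfl : ∀ u : ℝ, ⌊u * 2 ^ a⌋₊ / 2 ^ j = ⌊u * 2 ^ (a - j)⌋₊ := by
    intro u
    rw [← Nat.floor_div_natCast]
    congr 1
    have : (2 : ℝ) ^ a = 2 ^ (a - j) * 2 ^ j := by rw [← pow_add, Nat.sub_add_cancel hj]
    rw [this]
    push_cast
    field_simp
  have hi' : (i : ℝ) + 1 ≤ 2 ^ (a - j) := by exact_mod_cast hi
  have hae : ({u : ℝ | ⌊u * 2 ^ a⌋₊ / 2 ^ j = i} : Set ℝ) =ᵐ[(volume : Measure ℝ).restrict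
      (Set.Icc 0 1)] Set.Ico ((i : ℝ) / 2 ^ (a - j)) ((i + 1) / 2 ^ (a - j)) := by
    refine (ae_restrict_mem measurableSet_Icc).mono fun u hu => propext ?_
    change ⌊u * 2 ^ a⌋₊ / 2 ^ j = i ↔
      u ∈ Set.Ico ((i : ℝ) / 2 ^ (a - j)) ((i + 1) / 2 ^ (a - j))
    rw [hfl, Nat.floor_eq_iff (mul_nonneg hu.1 hm.le), Set.mem_Ico, div_le_iff₀ hm, lt_div_iff₀ hm]
  rw [measureReal_congr hae, measureReal_restrict_apply measurableSet_Ico,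
    Set.inter_eq_left.2, Real.volume_real_Ico_of_le]
  · field_simp
    ring
  · gcongr
    linarith
  · intro u hu
    exact ⟨le_trans (by positivity) hu.1, hu.2.le.trans ((div_le_one hm).2 hi')⟩

/-- The items that arrive during phase `j`. -/
def phaseItems (n j : ℕ) : Finset (Fin n) :=
  Finset.univ.filter fun k => phaseStart n j ≤ k ∧ (k : ℕ) < phaseStart n (j + 1)

theorem card_filter_phaseItems (n j : ℕ) (P : ℕ → Prop) [DecidablePred P] :
    ((phaseItems n j).filter fun k : Fin n => P k).card =
      ((Finset.Ico (phaseStart n j) (phaseStart n (j + 1))).filter P).card := by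
  rw [← Finset.card_map Fin.valEmbedding]
  congr 1
  ext l
  simp only [phaseItems, Finset.mem_map, Finset.mem_filter, Finset.mem_univ, true_and,
    Fin.valEmbedding_apply, Finset.mem_Ico]
  constructor
  · rintro ⟨k, hk, rfl⟩
    exact hk
  · rintro hl
    exact ⟨⟨l, hl.1.2.trans_le (phaseStart_le n _)⟩, hl, rfl⟩

theorem phaseCount_label (n a j i : ℕ) (x : Fin n → ℝ) :
    FillState.phaseCount n (label a x) j i (phaseStart n (j + 1)) =
      ((phaseItems n j).filter fun k => x k ∈ {u : ℝ | ⌊u * 2 ^ a⌋₊ / 2 ^ j = i}).card := by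
  rw [FillState.phaseCount, ← card_filter_phaseItems]
  congr 1
  refine Finset.filter_congr fun k _ => ?_
  rw [label_apply a x k.2]
  rfl

theorem card_phaseItems_bounds {n a j : ℕ} (hj : j ≤ a) :
    ((n / 2 ^ a : ℕ) : ℝ) / 2 ≤ (phaseItems n j).card * (2 ^ (a - j) : ℝ)⁻¹ ∧
      (phaseItems n j).card * (2 ^ (a - j) : ℝ)⁻¹ ≤ (((n / 2 ^ a : ℕ) : ℝ) + 1) / 2 := by
  have hm : (0 : ℝ) < 2 ^ (a - j) := by positivity
  have hcard : (phaseItems n j).card = phaseStart n (j + 1) - phaseStart n j := by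
    have := card_filter_phaseItems n j fun _ => True
    simpa using this
  have h1 := phaseStart_add n j
  have h2 := phaseStart_add n (j + 1)
  rw [pow_succ, ← Nat.div_div_eq_div_mul] at h2
  have h3 : n / 2 ^ a = n / 2 ^ j / 2 ^ (a - j) := by
    rw [Nat.div_div_eq_div_mul, ← pow_add, Nat.add_sub_cancel' hj]
  have h4 := Nat.div_mul_le_self (n / 2 ^ j) (2 ^ (a - j))
  have h5 := Nat.lt_div_mul_add (a := n / 2 ^ j) (Nat.two_pow_pos (a - j))
  rw [← h3] at h4 h5
  have h6 : n / 2 ^ j ≤ 2 * (phaseItems n j).card := by omega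
  have h7 : 2 * (phaseItems n j).card ≤ n / 2 ^ j + 1 := by omega
  have h8 : n / 2 ^ a * 2 ^ (a - j) ≤ 2 * (phaseItems n j).card := h4.trans h6
  have h9 : 2 * (phaseItems n j).card ≤ (n / 2 ^ a + 1) * 2 ^ (a - j) := by
    rw [add_mul, one_mul]
    omega
  have h8' : ((n / 2 ^ a : ℕ) : ℝ) * 2 ^ (a - j) ≤ 2 * (phaseItems n j).card := by
    exact_mod_cast h8
  have h9' : 2 * ((phaseItems n j).card : ℝ) ≤ (((n / 2 ^ a : ℕ) : ℝ) + 1) * 2 ^ (a - j) := by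
    exact_mod_cast h9
  rw [← div_eq_mul_inv, le_div_iff₀ hm, div_le_iff₀ hm]
  constructor <;> linarith

theorem exp_quarter_lt : Real.exp (1 / 4) < 1.285 := by
  refine lt_of_pow_lt_pow_left₀ 4 (by norm_num) ?_
  rw [← Real.exp_nat_mul]
  norm_num
  exact Real.exp_one_lt_d9.trans (by norm_num)

theorem exp_neg_quarter_lt : Real.exp (-(1 / 4)) < 0.78 := by
  rw [Real.exp_neg, inv_lt_comm₀ (Real.exp_pos _) (by norm_num)]
  refine lt_of_pow_lt_pow_left₀ 4 (Real.exp_pos _).le ?_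
  rw [← Real.exp_nat_mul]
  norm_num
  exact lt_trans (by norm_num) Real.exp_one_gt_d9

theorem uniformCube_lt_phaseCount_le {n a j i : ℕ} (hj : j ≤ a) (hi : i < 2 ^ (a - j)) :
    (uniformCube n).real {x | 3 * (n / 2 ^ a) / 4 <
      FillState.phaseCount n (label a x) j i (phaseStart n (j + 1))} ≤
      Real.exp (1 - ((n / 2 ^ a : ℕ) : ℝ) / 100) := by
  obtain ⟨-, hw⟩ := card_phaseItems_bounds (n := n) hj
  rw [← measureReal_floor_div_eq hj hi] at hw
  set L := n / 2 ^ a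
  have key := measureReal_pi_le_exp ((volume : Measure ℝ).restrict (Set.Icc 0 1))
    (measurableSet_floor_div_eq a j i) (phaseItems n j) (1 / 4) (3 * L / 16)
  refine le_trans (measureReal_mono (μ := uniformCube n) ?_) (key.trans (Real.exp_le_exp.2 ?_))
  · intro x hx
    simp only [Set.mem_ofPred_eq, phaseCount_label] at hx ⊢
    have : 3 * L ≤ 4 * ((phaseItems n j).filter fun k => ⌊x k * 2 ^ a⌋₊ / 2 ^ j = i).card := by
      omega
    have : 3 * (L : ℝ) ≤
        4 * ((phaseItems n j).filter fun k => ⌊x k * 2 ^ a⌋₊ / 2 ^ j = i).card := by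
      exact_mod_cast this
    linarith
  · have h1 := exp_quarter_lt
    have h2 : 1 ≤ Real.exp (1 / 4) := Real.one_le_exp (by norm_num)
    have h3 := mul_le_mul hw (sub_le_sub_right h1.le 1) (by linarith) (by positivity)
    have h4 : (0 : ℝ) ≤ L := by positivity
    norm_num at h3 ⊢
    linarith

theorem uniformCube_phaseCount_lt_le {n a j i : ℕ} (hj : j ≤ a) (hi : i < 2 ^ (a - j)) :
    (uniformCube n).real {x | 2 * FillState.phaseCount n (label a x) j i (phaseStart n (j + 1)) <
      3 * (n / 2 ^ a) / 4} ≤ Real.exp (1 - ((n / 2 ^ a : ℕ) : ℝ) / 100) := by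
  obtain ⟨hw, -⟩ := card_phaseItems_bounds (n := n) hj
  rw [← measureReal_floor_div_eq hj hi] at hw
  set L := n / 2 ^ a
  have key := measureReal_pi_le_exp ((volume : Measure ℝ).restrict (Set.Icc 0 1))
    (measurableSet_floor_div_eq a j i) (phaseItems n j) (-(1 / 4)) (-(3 * L / 32))
  refine le_trans (measureReal_mono (μ := uniformCube n) ?_) (key.trans (Real.exp_le_exp.2 ?_))
  · intro x hx
    simp only [Set.mem_ofPred_eq, phaseCount_label] at hx ⊢
    have : 8 * ((phaseItems n j).filter fun k => ⌊x k * 2 ^ a⌋₊ / 2 ^ j = i).card ≤ 3 * L := by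
      omega
    have : 8 * (((phaseItems n j).filter fun k => ⌊x k * 2 ^ a⌋₊ / 2 ^ j = i).card : ℝ) ≤
        3 * L := by
      exact_mod_cast this
    linarith
  · have h1 := exp_neg_quarter_lt
    have h4 : (0 : ℝ) ≤ L := by positivity
    have h3 := mul_le_mul hw (sub_le_sub_left h1.le 1) (by norm_num) (le_trans (by positivity) hw)
    norm_num at h3 ⊢
    linarith

theorem uniformCube_ae_mem_Ico (n : ℕ) : ∀ᵐ x ∂uniformCube n, ∀ k, x k ∈ Set.Ico (0 : ℝ) 1 := by
  refine ae_all_iff.2 fun k => ?_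
  have h : ∀ᵐ u ∂(volume : Measure ℝ).restrict (Set.Icc 0 1), u ∈ Set.Ico (0 : ℝ) 1 := by
    rw [← restrict_Ico_eq_restrict_Icc]
    exact ae_restrict_mem measurableSet_Ico
  exact (measurePreserving_eval (fun _ : Fin n => (volume : Measure ℝ).restrict (Set.Icc 0 1))
    k).quasiMeasurePreserving.ae h

theorem uniformCube_balanced_ge (n a : ℕ) :
    1 - a * 2 ^ a * (2 * Real.exp (1 - ((n / 2 ^ a : ℕ) : ℝ) / 100)) ≤ (uniformCube n).real
      {x | (∀ k, 0 ≤ x k) ∧ FillState.Balanced n a (3 * (n / 2 ^ a) / 4) (label a x)} := by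
  set ε := Real.exp (1 - ((n / 2 ^ a : ℕ) : ℝ) / 100)
  set h := 3 * (n / 2 ^ a) / 4
  set N : ℕ → ℕ → (Fin n → ℝ) → ℕ := fun j i x =>
    FillState.phaseCount n (label a x) j i (phaseStart n (j + 1))
  set G := {x : Fin n → ℝ | (∀ k, 0 ≤ x k) ∧ FillState.Balanced n a h (label a x)}
  set Z := {x : Fin n → ℝ | ¬ ∀ k, x k ∈ Set.Ico (0 : ℝ) 1}
  set B := ⋃ j ∈ Finset.range a, ⋃ i ∈ Finset.range (2 ^ (a - j)),
    ({x | h < N j i x} ∪ {x | 2 * N j i x < h})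
  have hZ : (uniformCube n).real Z = 0 := by
    rw [measureReal_eq_zero_iff]
    exact uniformCube_ae_mem_Ico n
  have hB : (uniformCube n).real B ≤ a * 2 ^ a * (2 * ε) := by
    refine (measureReal_biUnion_finset_le _ _).trans ?_
    have hj : ∀ j ∈ Finset.range a, (uniformCube n).real (⋃ i ∈ Finset.range (2 ^ (a - j)),
        ({x | h < N j i x} ∪ {x | 2 * N j i x < h})) ≤ 2 ^ a * (2 * ε) := by
      intro j hj
      have hja := (Finset.mem_range.1 hj).le
      refine (measureReal_biUnion_finset_le _ _).trans ?_
      have hi : ∀ i ∈ Finset.range (2 ^ (a - j)),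
          (uniformCube n).real ({x | h < N j i x} ∪ {x | 2 * N j i x < h}) ≤ 2 * ε := by
        intro i hi
        rw [Finset.mem_range] at hi
        refine (measureReal_union_le _ _).trans ?_
        rw [two_mul]
        exact add_le_add (uniformCube_lt_phaseCount_le hja hi) (uniformCube_phaseCount_lt_le hja hi)
      refine (Finset.sum_le_sum hi).trans ?_
      rw [Finset.sum_const, Finset.card_range, nsmul_eq_mul]
      push_cast
      gcongr
      · norm_num
      · omega
    refine (Finset.sum_le_sum hj).trans ?_
    rw [Finset.sum_const, Finset.card_range, nsmul_eq_mul, mul_assoc]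
  have hcover : (Set.univ : Set (Fin n → ℝ)) ⊆ G ∪ (Z ∪ B) := by
    intro x _
    by_contra hx
    simp only [Set.mem_union, not_or] at hx
    obtain ⟨hxG, hxZ, hxB⟩ := hx
    have hxI : ∀ k, x k ∈ Set.Ico (0 : ℝ) 1 := not_not.1 hxZ
    simp only [B, Set.mem_iUnion, Set.mem_union, Set.mem_ofPred_eq, not_exists, not_or,
      Finset.mem_range, not_lt] at hxB
    refine hxG ⟨fun k => (hxI k).1, ⟨fun k hk => ?_, fun j hj i hi => (hxB j hj i hi).1,
      fun j hj i hi => (hxB j hj i hi).2⟩⟩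
    rw [label_apply a x hk, Nat.floor_lt (mul_nonneg (hxI _).1 (by positivity))]
    push_cast
    exact mul_lt_of_lt_one_left (by positivity) (hxI _).2
  have h1 : (1 : ℝ) = (uniformCube n).real Set.univ := by simp
  have h2 := measureReal_mono (μ := uniformCube n) hcover
  have h3 := measureReal_union_le (μ := uniformCube n) G (Z ∪ B)
  have h4 := measureReal_union_le (μ := uniformCube n) Z B
  linarith

theorem exists_strategy_of_le_log {n : ℕ} (hl : 20000 ≤ Real.log n) :
    ∃ S : OnlineStrategy n, 1 - 6 / (n : ℝ) ^ 10 ≤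
      (uniformCube n).real {x | strategyCost S x ≤ Real.log n ^ 3} := by
  set l := Real.log n with hl_def
  have hn0 : 0 < n := by
    rcases Nat.eq_zero_or_pos n with h | h
    · rw [hl_def, h] at hl
      norm_num at hl
    · exact h
  have hnR : (0 : ℝ) < n := by exact_mod_cast hn0
  have hn1 : (1 : ℝ) ≤ n := by exact_mod_cast hn0
  have hexp : Real.exp l = n := Real.exp_log hnR
  set Q := ⌈1500 * l⌉₊
  have hQ1 : 1500 * l ≤ Q := Nat.le_ceil _
  have hQ2 : (Q : ℝ) < 1500 * l + 1 := Nat.ceil_lt_add_one (by linarith)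
  have hQ0 : 0 < Q := Nat.ceil_pos.2 (by linarith)
  have hQn : Q ≤ n := by
    have h := Real.quadratic_le_exp_of_nonneg (x := l) (by linarith)
    rw [hexp] at h
    have : (Q : ℝ) ≤ n := by nlinarith
    exact_mod_cast this
  set a := Nat.log 2 (n / Q)
  have hnQ : n / Q ≠ 0 := (Nat.div_pos hQn hQ0).ne'
  have ha1 : 2 ^ a * Q ≤ n := (Nat.le_div_iff_mul_le hQ0).1 (Nat.pow_log_le_self 2 hnQ)
  have ha2 : n < 2 ^ (a + 1) * Q :=
    (Nat.div_lt_iff_lt_mul hQ0).1 (Nat.lt_pow_succ_log_self one_lt_two _)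
  have han : 2 ^ a ≤ n := (Nat.le_mul_of_pos_right _ hQ0).trans ha1
  have hanR : (2 : ℝ) ^ a ≤ n := by exact_mod_cast han
  have h2a : (0 : ℝ) < 2 ^ a := by positivity
  have ha2R : (n : ℝ) / 2 ^ a ≤ 2 * Q := by
    rw [div_le_iff₀ h2a]
    have : (n : ℝ) < 2 ^ (a + 1) * Q := by exact_mod_cast ha2
    rw [pow_succ] at this
    linarith
  have hQL : Q ≤ n / 2 ^ a := by
    rw [Nat.le_div_iff_mul_le (Nat.two_pow_pos a), mul_comm]
    exact ha1
  have hQLR : (Q : ℝ) ≤ (n / 2 ^ a : ℕ) := by exact_mod_cast hQL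
  have hal : (a : ℝ) ≤ 2 * l := by
    have h := Real.log_le_log h2a hanR
    rw [Real.log_pow] at h
    have := Real.log_two_gt_d9
    nlinarith [(Nat.cast_nonneg a : (0 : ℝ) ≤ a)]
  have haR : (a : ℝ) ≤ n := (by exact_mod_cast a.lt_two_pow_self.le : (a : ℝ) ≤ 2 ^ a).trans hanR
  refine ⟨fillStrategy n a (3 * (n / 2 ^ a) / 4), le_trans ?_
    ((uniformCube_balanced_ge n a).trans (measureReal_mono ?_))⟩
  · have hε : Real.exp (1 - ((n / 2 ^ a : ℕ) : ℝ) / 100) ≤ 3 * ((n : ℝ) ^ 15)⁻¹ := by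
      calc _ ≤ Real.exp (1 + -((15 : ℕ) * l)) := Real.exp_le_exp.2 (by push_cast; linarith)
        _ = Real.exp 1 * ((n : ℝ) ^ 15)⁻¹ := by
            rw [Real.exp_add, Real.exp_neg, Real.exp_nat_mul, hexp]
        _ ≤ _ := by
            gcongr
            exact Real.exp_one_lt_d9.le.trans (by norm_num)
    have h1 : (a : ℝ) * 2 ^ a * (2 * Real.exp (1 - ((n / 2 ^ a : ℕ) : ℝ) / 100)) ≤
        n * n * (2 * (3 * ((n : ℝ) ^ 15)⁻¹)) := by
      gcongr
    have h2 : (n : ℝ) * n * (2 * (3 * ((n : ℝ) ^ 15)⁻¹)) = 6 / (n : ℝ) ^ 13 := by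
      field_simp
      norm_num
    have h3 : 6 / (n : ℝ) ^ 13 ≤ 6 / (n : ℝ) ^ 10 := by
      gcongr
      norm_num
    linarith
  · rintro x ⟨hx, hy⟩
    refine (strategyCost_fillStrategy_le hx hy han (by omega)).trans ?_
    rw [mul_div_assoc]
    have h0 : (0 : ℝ) ≤ a := Nat.cast_nonneg a
    have h1 : 2 * ((a : ℝ) + 1) * (n / 2 ^ a) ≤ 2 * (2 * l + 1) * (3002 * l) := by
      gcongr
      linarith
    have h2 : 20000 * l ^ 2 ≤ l ^ 3 := by nlinarith [sq_nonneg l]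
    nlinarith

/-- There is a deterministic algorithm for stochastic online sorting achieving
cost `polylog n` with probability `1 - O(1/n^10)`. -/
theorem stochastic_online_sorting_high_prob :
    ∃ C : ℝ, 0 < C ∧ ∀ n : ℕ, 2 ≤ n → ∃ S : OnlineStrategy n,
      ENNReal.ofReal (1 - C / (n : ℝ) ^ 10) ≤
        uniformCube n {x | strategyCost S x ≤ Real.log n ^ (C : ℝ)} := by
  refine ⟨Real.exp 200000, Real.exp_pos _, fun n hn => ?_⟩
  have hn0 : (0 : ℝ) < n := by exact_mod_cast (by omega : 0 < n)
  have hC := Real.add_one_le_exp 200000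
  rcases le_total 20000 (Real.log n) with hl | hl
  · obtain ⟨S, hS⟩ := exists_strategy_of_le_log hl
    refine ⟨S, ENNReal.ofReal_le_of_le_toReal (le_trans ?_ (hS.trans (measureReal_mono ?_)))⟩
    · gcongr
      linarith
    · intro x hx
      refine le_trans (show strategyCost S x ≤ Real.log n ^ 3 from hx) ?_
      rw [← Real.rpow_natCast]
      exact Real.rpow_le_rpow_of_exponent_le (by linarith) (by push_cast; linarith)
  · refine ⟨fillStrategy n 0 0, ?_⟩
    have h : (n : ℝ) ^ 10 ≤ Real.exp 200000 := by
      rw [← Real.exp_log hn0, ← Real.exp_nat_mul]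
      exact Real.exp_le_exp.2 (by push_cast; linarith)
    rw [ENNReal.ofReal_of_nonpos (sub_nonpos.2 ((one_le_div (by positivity)).2 h))]
    exact zero_le
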